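/- arXiv:0912.5003 — 2 statements merged into one kernel-verified Lean document; each statement's English description precedes it below -/
import Mathlib

section
/- Let Λ be an artin algebra and let U ⊆ V ⊆ W be finite length Λ-modules. If U is a piling submodule of V and V is a piling submodule of W, then U is a piling submodule of W. -/
/-!
Setting: `k` is a commutative artinian ring and `Λ` an artin `k`-algebra
(an algebra over `k` which is finitely generated as a `k`-module).
All modules considered are `Λ`-modules of finite length (`IsFiniteLength Λ M`),
and `|M|` denotes the length of `M`, implemented as the height
`Order.height (⊤ : Submodule Λ M)` of the lattice of submodules
(for a submodule `N` of an ambient module, its length is `Order.height N`).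
-/

universe u v

open Submodule

section GRDefs

variable (Λ : Type u) [Ring Λ]

/-- A submodule `N` of an ambient module is indecomposable (as a module):
it is nonzero, and whenever it is the direct sum of two submodules, one of them is zero. -/
def IndecSub {Y : Type v} [AddCommGroup Y] [Module Λ Y] (N : Submodule Λ Y) : Prop :=
  N ≠ ⊥ ∧ ∀ A B : Submodule Λ Y, A ≤ N → B ≤ N → A ⊔ B = N → A ⊓ B = ⊥ → A = ⊥ ∨ B = ⊥

/-- A module is indecomposable iff its top submodule is. -/
def IndecMod (M : Type v) [AddCommGroup M] [Module Λ M] : Prop :=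
  IndecSub Λ (⊤ : Submodule Λ M)

/-- The length `|M|` of a module, as an extended natural number. -/
noncomputable def modLen (M : Type v) [AddCommGroup M] [Module Λ M] : ℕ∞ :=
  Order.height (⊤ : Submodule Λ M)

/-- The length `|N|` of a submodule of an ambient module, as a natural number. -/
noncomputable def subLen {Y : Type v} [AddCommGroup Y] [Module Λ Y] (N : Submodule Λ Y) : ℕ :=
  (Order.height N).toNat

open Classical in
/-- Fuel-based auxiliary function for the Gabriel-Roiter measure. -/
noncomputable def muAux {Y : Type v} [AddCommGroup Y] [Module Λ Y] :
    ℕ → Submodule Λ Y → ℝ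
  | 0, _ => 0
  | n + 1, N =>
      (if IndecSub Λ N then (2 : ℝ) ^ (-(subLen Λ N : ℤ)) else 0)
        + sSup (muAux n '' {N' : Submodule Λ Y | N' < N})

/-- The Gabriel-Roiter measure `μ(N)` of a submodule `N` of an ambient module:
`μ(0) = 0`; if `N ≠ 0` is decomposable, `μ(N)` is the maximum of `μ(N')` over proper
submodules `N'` of `N`; if `N` is indecomposable, `μ(N) = 2^(-|N|)` plus this maximum.
(For modules of finite length the supremum is a maximum and the fuel `|N|` suffices for
the recursion, so this agrees with the usual inductive definition; the measure of a
submodule depends only on the sublattice of its submodules, hence it does not matter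
in which ambient module it is computed.) -/
noncomputable def mu {Y : Type v} [AddCommGroup Y] [Module Λ Y] (N : Submodule Λ Y) : ℝ :=
  muAux Λ (subLen Λ N) N

/-- The Gabriel-Roiter measure of a module. -/
noncomputable def muMod (M : Type v) [AddCommGroup M] [Module Λ M] : ℝ :=
  mu Λ (⊤ : Submodule Λ M)

/-- `X` is a Gabriel-Roiter submodule of the (indecomposable, non-simple) ambient
module `Y`: `X` is an indecomposable proper submodule with `μ(Y) = μ(X) + 2^(-|Y|)`. -/
def IsGRSub {Y : Type v} [AddCommGroup Y] [Module Λ Y] (X : Submodule Λ Y) : Prop :=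
  IndecMod Λ Y ∧ IndecSub Λ X ∧ X ≠ ⊤ ∧
    mu Λ (⊤ : Submodule Λ Y) = mu Λ X + (2 : ℝ) ^ (-(subLen Λ (⊤ : Submodule Λ Y) : ℤ))

/-- A map `u : X → Y` is a Gabriel-Roiter inclusion iff it is injective and its
image is a Gabriel-Roiter submodule of `Y`. -/
def IsGRInclusion {X Y : Type v} [AddCommGroup X] [Module Λ X] [AddCommGroup Y] [Module Λ Y]
    (u : X →ₗ[Λ] Y) : Prop :=
  Function.Injective u ∧ IsGRSub Λ (LinearMap.range u)

/-- A linear map is a split monomorphism. -/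
def IsSplitMonoHom {A B : Type v} [AddCommGroup A] [Module Λ A] [AddCommGroup B] [Module Λ B]
    (f : A →ₗ[Λ] B) : Prop :=
  ∃ g : B →ₗ[Λ] A, g.comp f = LinearMap.id

/-- A linear map is a split epimorphism. -/
def IsSplitEpiHom {A B : Type v} [AddCommGroup A] [Module Λ A] [AddCommGroup B] [Module Λ B]
    (f : A →ₗ[Λ] B) : Prop :=
  ∃ g : B →ₗ[Λ] A, f.comp g = LinearMap.id

/-- A morphism `f` in the category of finite length `Λ`-modules is irreducible if it is
neither a split monomorphism nor a split epimorphism and, whenever `f = g ∘ h` with the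
intermediate module of finite length, either `h` is a split monomorphism or `g` is a
split epimorphism. -/
def IsIrreducibleHom {A B : Type v} [AddCommGroup A] [Module Λ A] [AddCommGroup B] [Module Λ B]
    (f : A →ₗ[Λ] B) : Prop :=
  ¬ IsSplitMonoHom Λ f ∧ ¬ IsSplitEpiHom Λ f ∧
    ∀ (Z : Type v) [AddCommGroup Z] [Module Λ Z], IsFiniteLength Λ Z →
      ∀ (h : A →ₗ[Λ] Z) (g : Z →ₗ[Λ] B), f = g.comp h →
        IsSplitMonoHom Λ h ∨ IsSplitEpiHom Λ g

/-- An indecomposable submodule `U` of the ambient module is piling provided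
`μ(V) ≤ μ(U)` for every indecomposable submodule `V` with `|V| ≤ |U|`. -/
def IsPilingSub {Y : Type v} [AddCommGroup Y] [Module Λ Y] (U : Submodule Λ Y) : Prop :=
  IndecSub Λ U ∧ ∀ V : Submodule Λ Y, IndecSub Λ V →
    Order.height V ≤ Order.height U → mu Λ V ≤ mu Λ U

/-- A Gabriel-Roiter filtration `c 0 ⊂ c 1 ⊂ ⋯ ⊂ c t = N` of an (indecomposable)
submodule `N`: a chain of indecomposable submodules starting at a simple module such
that each inclusion `c i ⊂ c (i+1)` is a Gabriel-Roiter inclusion,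
i.e. `μ(c (i+1)) = μ(c i) + 2^(-|c (i+1)|)`. -/
def IsGRFiltration {Y : Type v} [AddCommGroup Y] [Module Λ Y] {t : ℕ}
    (c : Fin (t + 1) → Submodule Λ Y) (N : Submodule Λ Y) : Prop :=
  c (Fin.last t) = N ∧
  IsSimpleModule Λ (c 0) ∧
  (∀ i : Fin (t + 1), IndecSub Λ (c i)) ∧
  ∀ i : Fin t, c i.castSucc < c i.succ ∧
    mu Λ (c i.succ) = mu Λ (c i.castSucc) + (2 : ℝ) ^ (-(subLen Λ (c i.succ) : ℤ))

/-- A brick: a nonzero module all of whose nonzero endomorphisms are invertible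
(i.e. the endomorphism ring is a division ring). -/
def IsBrick (M : Type v) [AddCommGroup M] [Module Λ M] : Prop :=
  (∃ x : M, x ≠ 0) ∧ ∀ f : M →ₗ[Λ] M, f ≠ 0 → Function.Bijective f

/-- An `M`-filtration `0 = c 0 ⊂ c 1 ⊂ ⋯ ⊂ c m = Y` of the module `Y`
(so `c j` is the module `M[j]`, with `M[0] = 0`, and the `M`-length of `Y` is `m`):
all consecutive factors `c (i+1) / c i` are isomorphic to `M`. -/
structure IsMFiltration (M : Type v) [AddCommGroup M] [Module Λ M]
    {Y : Type v} [AddCommGroup Y] [Module Λ Y] {m : ℕ}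
    (c : Fin (m + 1) → Submodule Λ Y) : Prop where
  bot : c 0 = ⊥
  top : c (Fin.last m) = ⊤
  lt : ∀ i : Fin m, c i.castSucc < c i.succ
  quot : ∀ i : Fin m,
    Nonempty ((↥(c i.succ) ⧸ comap (c i.succ).subtype (c i.castSucc)) ≃ₗ[Λ] M)

/-- A homogeneous `M`-filtration: an `M`-filtration in which moreover all the
`M[i] = c i` with `i ≥ 1` are indecomposable and all the inclusions
`M[i-1] ⊂ M[i]` for `2 ≤ i ≤ m` are irreducible monomorphisms. -/
structure IsHomogMFiltration (M : Type v) [AddCommGroup M] [Module Λ M]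
    {Y : Type v} [AddCommGroup Y] [Module Λ Y] {m : ℕ}
    (c : Fin (m + 1) → Submodule Λ Y) extends IsMFiltration Λ M c : Prop where
  indec : ∀ i : Fin (m + 1), i ≠ 0 → IndecSub Λ (c i)
  irr : ∀ i : Fin m, (i : ℕ) ≠ 0 →
    IsIrreducibleHom Λ (Submodule.inclusion (toIsMFiltration.lt i).le)

end GRDefs

section GRLemmas

variable {Λ : Type u} [Ring Λ]

section Ambient

variable {Y : Type v} [AddCommGroup Y] [Module Λ Y]

theorem muAux_nonneg (n : ℕ) (N : Submodule Λ Y) : 0 ≤ muAux Λ n N := by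
  induction n generalizing N with
  | zero => exact le_rfl
  | succ n ih =>
    rw [muAux]
    refine add_nonneg (by split_ifs <;> positivity) (Real.sSup_nonneg ?_)
    rintro _ ⟨N', -, rfl⟩
    exact ih N'

theorem mu_nonneg (N : Submodule Λ Y) : 0 ≤ mu Λ N :=
  muAux_nonneg _ N

theorem height_map_of_injective {X : Type v} [AddCommGroup X] [Module Λ X] {f : X →ₗ[Λ] Y}
    (hf : Function.Injective f) (N : Submodule Λ X) :
    Order.height (N.map f) = Order.height N := by
  rw [← Module.length_submodule, ← Module.length_submodule]
  exact (N.equivMapOfInjective f hf).length_eq.symm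

theorem exists_map_eq_of_le_map {X : Type v} [AddCommGroup X] [Module Λ X] {f : X →ₗ[Λ] Y}
    {N : Submodule Λ X} {A : Submodule Λ Y} (h : A ≤ N.map f) :
    ∃ B : Submodule Λ X, B.map f = A :=
  ⟨A.comap f, Submodule.map_comap_eq_of_le (h.trans LinearMap.map_le_range)⟩

theorem indecSub_map_iff {X : Type v} [AddCommGroup X] [Module Λ X] {f : X →ₗ[Λ] Y}
    (hf : Function.Injective f) (N : Submodule Λ X) :
    IndecSub Λ (N.map f) ↔ IndecSub Λ N := by
  have hinj := Submodule.map_injective_of_injective hf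
  have hbot : ∀ A : Submodule Λ X, A.map f = ⊥ ↔ A = ⊥ := fun A => by
    rw [← Submodule.map_bot f, hinj.eq_iff]
  have hle : ∀ A B : Submodule Λ X, A.map f ≤ B.map f ↔ A ≤ B := fun A B =>
    Submodule.map_le_map_iff_of_injective hf A B
  constructor
  · rintro ⟨h0, h⟩
    refine ⟨fun hN => h0 ((hbot N).mpr hN), fun A B hA hB hs hi => ?_⟩
    simpa only [hbot] using h (A.map f) (B.map f) ((hle _ _).mpr hA) ((hle _ _).mpr hB)
      (by rw [← Submodule.map_sup, hs]) (by rw [← Submodule.map_inf f hf, hi, Submodule.map_bot])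
  · rintro ⟨h0, h⟩
    refine ⟨fun hN => h0 ((hbot N).mp hN), fun A B hA hB hs hi => ?_⟩
    obtain ⟨A, rfl⟩ := exists_map_eq_of_le_map hA
    obtain ⟨B, rfl⟩ := exists_map_eq_of_le_map hB
    rw [← Submodule.map_sup, hinj.eq_iff] at hs
    rw [← Submodule.map_inf f hf, hbot] at hi
    simpa only [hbot] using h A B ((hle _ _).mp hA) ((hle _ _).mp hB) hs hi

theorem subLen_map_of_injective {X : Type v} [AddCommGroup X] [Module Λ X] {f : X →ₗ[Λ] Y}
    (hf : Function.Injective f) (N : Submodule Λ X) :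
    subLen Λ (N.map f) = subLen Λ N := by
  rw [subLen, subLen, height_map_of_injective hf]

theorem muAux_map_of_injective {X : Type v} [AddCommGroup X] [Module Λ X] {f : X →ₗ[Λ] Y}
    (hf : Function.Injective f) (n : ℕ) (N : Submodule Λ X) :
    muAux Λ n (N.map f) = muAux Λ n N := by
  induction n generalizing N with
  | zero => rfl
  | succ n ih =>
    rw [muAux, muAux, subLen_map_of_injective hf, propext (indecSub_map_iff hf N)]
    congr 2
    have hlt : ∀ A B : Submodule Λ X, A.map f < B.map f ↔ A < B := fun A B => by
      simp only [lt_iff_le_not_ge, Submodule.map_le_map_iff_of_injective hf]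
    ext x
    constructor
    · rintro ⟨A, hA, rfl⟩
      obtain ⟨A, rfl⟩ := exists_map_eq_of_le_map (le_of_lt hA)
      exact ⟨A, (hlt _ _).mp hA, (ih A).symm⟩
    · rintro ⟨A, hA, rfl⟩
      exact ⟨A.map f, (hlt _ _).mpr hA, ih A⟩

theorem mu_map_of_injective {X : Type v} [AddCommGroup X] [Module Λ X] {f : X →ₗ[Λ] Y}
    (hf : Function.Injective f) (N : Submodule Λ X) :
    mu Λ (N.map f) = mu Λ N := by
  rw [mu, mu, subLen_map_of_injective hf, muAux_map_of_injective hf]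

end Ambient

theorem sSup_mem_range_intCast_div {m : ℝ} (hm : 0 < m) {S : Set ℝ}
    (hS : S ⊆ Set.range fun z : ℤ => (z : ℝ) / m) :
    sSup S ∈ Set.range fun z : ℤ => (z : ℝ) / m := by
  have h0 : (0 : ℝ) ∈ Set.range fun z : ℤ => (z : ℝ) / m := ⟨0, by simp⟩
  rcases S.eq_empty_or_nonempty with rfl | hne
  · rwa [Real.sSup_empty]
  by_cases hb : BddAbove S
  · have hcl : IsClosed (Set.range fun z : ℤ => (z : ℝ) / m) :=
      ((Homeomorph.mulRight₀ m⁻¹ (inv_ne_zero hm.ne')).isClosedEmbedding.comp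
        Int.isClosedEmbedding_coe_real).isClosed_range
    exact hcl.closure_subset_iff.mpr hS (csSup_mem_closure hne hb)
  · rwa [Real.sSup_of_not_bddAbove hb]

section FiniteLength

variable {Y : Type v} [AddCommGroup Y] [Module Λ Y] [IsNoetherian Λ Y] [IsArtinian Λ Y]

theorem height_submodule_ne_top (N : Submodule Λ Y) : Order.height N ≠ ⊤ := by
  rw [← Module.length_submodule]
  exact Module.length_ne_top

theorem coe_subLen (N : Submodule Λ Y) : (subLen Λ N : ℕ∞) = Order.height N :=
  ENat.natCast_toNat (height_submodule_ne_top N)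

theorem subLen_le_subLen_iff {M N : Submodule Λ Y} :
    subLen Λ M ≤ subLen Λ N ↔ Order.height M ≤ Order.height N := by
  rw [← coe_subLen, ← coe_subLen, Nat.cast_le]

theorem subLen_strictMono : StrictMono (subLen Λ : Submodule Λ Y → ℕ) := by
  intro M N h
  have := Order.height_strictMono h (height_submodule_ne_top M).lt_top
  rw [← coe_subLen, ← coe_subLen] at this
  exact_mod_cast this

theorem muAux_congr_fuel {n m : ℕ} {N : Submodule Λ Y} (hn : subLen Λ N ≤ n)
    (hm : subLen Λ N ≤ m) : muAux Λ n N = muAux Λ m N := by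
  have key : ∀ n, muAux Λ n (⊥ : Submodule Λ Y) = 0 := by
    rintro (_ | n) <;> simp [muAux, IndecSub]
  induction n generalizing N m with
  | zero =>
    have hN : N = ⊥ := by
      by_contra hne
      have := subLen_strictMono (bot_lt_iff_ne_bot.mpr hne)
      omega
    rw [hN, key, key]
  | succ n ih =>
    rcases eq_or_ne N ⊥ with rfl | hne
    · rw [key, key]
    have hpos := subLen_strictMono (bot_lt_iff_ne_bot.mpr hne)
    obtain ⟨m, rfl⟩ := Nat.exists_eq_succ_of_ne_zero (show m ≠ 0 by omega)
    rw [muAux, muAux]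
    congr 2
    refine Set.image_congr fun N' h' => ?_
    have hlt := subLen_strictMono (show N' < N from h')
    exact ih (by omega) (by omega)

open Classical in
theorem mu_eq (N : Submodule Λ Y) :
    mu Λ N = (if IndecSub Λ N then (2 : ℝ) ^ (-(subLen Λ N : ℤ)) else 0)
      + sSup (mu Λ '' {N' : Submodule Λ Y | N' < N}) := by
  rw [mu, muAux_congr_fuel le_rfl (Nat.le_succ _), muAux]
  congr 2
  exact Set.image_congr fun N' h' => muAux_congr_fuel (subLen_strictMono h').le le_rfl

/-- The measure of a module of length at most `n` is an integral multiple of `2⁻ⁿ`. -/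
theorem mu_mem_range_div_two_pow {n : ℕ} {N : Submodule Λ Y} (h : subLen Λ N ≤ n) :
    mu Λ N ∈ Set.range fun z : ℤ => (z : ℝ) / 2 ^ n := by
  induction N using WellFoundedLT.induction with
  | ind N ih =>
    classical
    obtain ⟨z, hz⟩ := sSup_mem_range_intCast_div (m := 2 ^ n) (by positivity)
      (S := mu Λ '' {N' : Submodule Λ Y | N' < N}) (by
        rintro _ ⟨N', h', rfl⟩
        exact ih N' h' ((subLen_strictMono h').le.trans h))
    rw [mu_eq, ← hz]
    split_ifs
    · refine ⟨2 ^ (n - subLen Λ N) + z, ?_⟩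
      simp only [Int.cast_add, Int.cast_pow, Int.cast_ofNat, add_div, zpow_neg, zpow_natCast]
      congr 1
      rw [div_eq_iff (by positivity), pow_sub₀ _ two_ne_zero h, mul_comm]
    · exact ⟨z, by simp⟩

/-- Submodules of length greater than `n` contribute less than `2⁻ⁿ` to the measure. -/
theorem mu_le_add_max {n : ℕ} {c : ℝ} (hc : 0 ≤ c) {N : Submodule Λ Y}
    (h : ∀ M ≤ N, IndecSub Λ M → subLen Λ M ≤ n → mu Λ M ≤ c) :
    mu Λ N ≤ c + max 0 ((2 : ℝ) ^ (-(n : ℤ)) - 2 ^ (-(subLen Λ N : ℤ))) := by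
  induction N using WellFoundedLT.induction with
  | ind N ih =>
    classical
    have ih' : ∀ N' < N, mu Λ N' ≤
        c + max 0 ((2 : ℝ) ^ (-(n : ℤ)) - 2 ^ (-(subLen Λ N' : ℤ))) := fun N' h' =>
      ih N' h' fun M hM => h M (hM.trans h'.le)
    have hsup : ∀ b : ℝ, 0 ≤ b →
        (∀ N' < N, (2 : ℝ) ^ (-(n : ℤ)) - 2 ^ (-(subLen Λ N' : ℤ)) ≤ b) →
        sSup (mu Λ '' {N' : Submodule Λ Y | N' < N}) ≤ c + b := by
      intro b hb hN
      refine Real.sSup_le ?_ (add_nonneg hc hb)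
      rintro _ ⟨N', h', rfl⟩
      exact (ih' N' h').trans (by gcongr; exact max_le hb (hN N' h'))
    rcases le_or_gt (subLen Λ N) n with hle | hgt
    · by_cases hi : IndecSub Λ N
      · exact (h N le_rfl hi hle).trans (le_add_of_nonneg_right (le_max_left _ _))
      · rw [mu_eq, if_neg hi, zero_add]
        refine (hsup 0 le_rfl fun N' h' => ?_).trans (by gcongr; exact le_max_left _ _)
        have := subLen_strictMono h'
        exact sub_nonpos.mpr (zpow_le_zpow_right₀ one_le_two (by omega))
    · have hhalf : (2 : ℝ) ^ (-(subLen Λ N : ℤ) + 1) = 2 ^ (-(subLen Λ N : ℤ)) * 2 := by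
        rw [zpow_add_one₀ two_ne_zero]
      have hn : (2 : ℝ) ^ (-(subLen Λ N : ℤ) + 1) ≤ 2 ^ (-(n : ℤ)) :=
        zpow_le_zpow_right₀ one_le_two (by omega)
      have hs := hsup (2 ^ (-(n : ℤ)) - 2 ^ (-(subLen Λ N : ℤ) + 1)) (sub_nonneg.mpr hn)
        fun N' h' => by
          have := subLen_strictMono h'
          gcongr
          · exact one_le_two
          · omega
      have hif : (if IndecSub Λ N then (2 : ℝ) ^ (-(subLen Λ N : ℤ)) else 0)
          ≤ 2 ^ (-(subLen Λ N : ℤ)) := by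
        split_ifs
        · exact le_rfl
        · positivity
      have hmax := le_max_right 0 ((2 : ℝ) ^ (-(n : ℤ)) - 2 ^ (-(subLen Λ N : ℤ)))
      rw [mu_eq]
      linarith

theorem mu_lt_add {n : ℕ} {c : ℝ} (hc : 0 ≤ c) {N : Submodule Λ Y}
    (h : ∀ M ≤ N, IndecSub Λ M → subLen Λ M ≤ n → mu Λ M ≤ c) :
    mu Λ N < c + 1 / 2 ^ n := by
  refine (mu_le_add_max hc h).trans_lt ?_
  rw [one_div, ← zpow_natCast, ← zpow_neg]
  gcongr
  exact max_lt (by positivity) (sub_lt_self _ (by positivity))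

end FiniteLength

end GRLemmas

/-- Let `U ⊆ V ⊆ W`. If `U` is a piling submodule of `V` and `V` is a
piling submodule of `W`, then `U` is a piling submodule of `W`. (Here `U` regarded as a
submodule of the module `V` is `comap V.subtype U`.) -/
theorem gabriel_roiter_stmt9
    (k : Type u) [CommRing k] [IsArtinianRing k]
    (Λ : Type u) [Ring Λ] [Algebra k Λ] [Module.Finite k Λ]
    (W : Type v) [AddCommGroup W] [Module Λ W] (hWfl : IsFiniteLength Λ W)
    (V U : Submodule Λ W) (hUV : U ≤ V)
    (hU : IsPilingSub Λ (Submodule.comap V.subtype U))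
    (hV : IsPilingSub Λ V) :
    IsPilingSub Λ U := by
  obtain ⟨_, _⟩ := isFiniteLength_iff_isNoetherian_isArtinian.mp hWfl
  have hinj : Function.Injective V.subtype := V.injective_subtype
  have hmap : (U.comap V.subtype).map V.subtype = U :=
    Submodule.map_comap_eq_of_le (by rwa [Submodule.range_subtype])
  have hpil : ∀ M ≤ V, IndecSub Λ M → subLen Λ M ≤ subLen Λ U → mu Λ M ≤ mu Λ U := by
    intro M hM hi hl
    have hMmap : (M.comap V.subtype).map V.subtype = M :=
      Submodule.map_comap_eq_of_le (by rwa [Submodule.range_subtype])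
    rw [subLen_le_subLen_iff] at hl
    rw [← hMmap, ← hmap, height_map_of_injective hinj, height_map_of_injective hinj] at hl
    rw [← hMmap, indecSub_map_iff hinj] at hi
    rw [← hMmap, ← hmap, mu_map_of_injective hinj, mu_map_of_injective hinj]
    exact hU.2 _ hi hl
  refine ⟨by rw [← hmap, indecSub_map_iff hinj]; exact hU.1, fun X hX hXU => ?_⟩
  have hlt : mu Λ X < mu Λ U + 1 / 2 ^ subLen Λ U :=
    (hV.2 X hX (hXU.trans (Order.height_mono hUV))).trans_lt (mu_lt_add (mu_nonneg U) hpil)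
  obtain ⟨x, hx⟩ := mu_mem_range_div_two_pow (subLen_le_subLen_iff.mpr hXU)
  obtain ⟨y, hy⟩ := mu_mem_range_div_two_pow (le_refl (subLen Λ U))
  simp only at hx hy
  rw [← hx, ← hy, ← add_div, div_lt_div_iff_of_pos_right (by positivity)] at hlt
  rw [← hx, ← hy, div_le_div_iff_of_pos_right (by positivity)]
  exact_mod_cast Int.lt_add_one_iff.mp (by exact_mod_cast hlt)
end

section
/- Let Λ be an artin algebra and let X ⊂ Y be a Gabriel-Roiter inclusion. If Y' is a submodule of Y with X + Y' = Y, then |Y'| > |Y/X|, i.e. the length of Y' is strictly greater than |Y| − |X|. -/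
/-!
Setting: `k` is a commutative artinian ring and `Λ` an artin `k`-algebra
(an algebra over `k` which is finitely generated as a `k`-module).
All modules considered are `Λ`-modules of finite length (`IsFiniteLength Λ M`),
and `|M|` denotes the length of `M`, implemented as the height
`Order.height (⊤ : Submodule Λ M)` of the lattice of submodules
(for a submodule `N` of an ambient module, its length is `Order.height N`).
-/

universe u v

open Submodule

/-- Two submodules which span a module of finite length and meet nontrivially have lengths
adding up to more than the length of the module. -/
theorem Submodule.height_top_lt_height_add_height {R : Type*} {M : Type*} [Ring R]
    [AddCommGroup M] [Module R M] (hM : IsFiniteLength R M) {A B : Submodule R M}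
    (hsup : A ⊔ B = ⊤) (hinf : A ⊓ B ≠ ⊥) :
    Order.height (⊤ : Submodule R M) < Order.height A + Order.height B := by
  let f : (A × B) →ₗ[R] M := A.subtype.coprod B.subtype
  have hf : Function.Surjective f := by
    rw [← LinearMap.range_eq_top, LinearMap.range_coprod, range_subtype, range_subtype, hsup]
  obtain ⟨x, ⟨hA, hB⟩, hx⟩ := (Submodule.ne_bot_iff _).mp hinf
  have hker : Nontrivial (LinearMap.ker f) := by
    rw [Submodule.nontrivial_iff_ne_bot, Submodule.ne_bot_iff]
    refine ⟨(⟨x, hA⟩, -⟨x, hB⟩), by simp [f], fun h => hx ?_⟩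
    simpa using congrArg Prod.fst h
  have hadd := Module.length_eq_add_of_exact (LinearMap.ker f).subtype f
    (subtype_injective _) hf (LinearMap.exact_subtype_ker_map f)
  rw [Module.length_prod, Module.length_submodule, Module.length_submodule] at hadd
  rw [hadd, ← Module.length_eq_height, add_comm]
  simpa using (ENat.add_lt_add_iff_left (Module.length_ne_top_iff.mpr hM)).mpr
    (Module.length_pos (R := R) (M := LinearMap.ker f))

/-- Let `X ⊂ Y` be a Gabriel-Roiter inclusion. If `Y'` is a submodule
of `Y` with `X + Y' = Y`, then `|Y'| > |Y/X| = |Y| − |X|`, i.e. `|Y| < |X| + |Y'|`. -/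
theorem gabriel_roiter_stmt15
    (k : Type u) [CommRing k] [IsArtinianRing k]
    (Λ : Type u) [Ring Λ] [Algebra k Λ] [Module.Finite k Λ]
    (Y : Type v) [AddCommGroup Y] [Module Λ Y] (hYfl : IsFiniteLength Λ Y)
    (X : Submodule Λ Y) (hX : IsGRSub Λ X)
    (Y' : Submodule Λ Y) (hsum : X ⊔ Y' = ⊤) :
    modLen Λ Y < Order.height X + Order.height Y' := by
  obtain ⟨⟨_, hY⟩, ⟨hX0, _⟩, hXtop, _⟩ := hX
  refine Submodule.height_top_lt_height_add_height hYfl hsum fun hinf => ?_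
  rcases hY X Y' le_top le_top hsum hinf with h | h
  · exact hX0 h
  · exact hXtop (by rwa [h, sup_bot_eq] at hsum)
end
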